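/- The Coxeter–Dickson order is an even unimodular lattice of rank 8: the 8×8 matrix with entries ⟨b_i, b_j⟩ has determinant 1, and ⟨x, x⟩ ∈ 2ℤ for every x ∈ Λ. -/

import Mathlib

noncomputable section

open Quaternion

/-- The octonions as the Cayley–Dickson double of the quaternions. -/
abbrev Octo : Type := ℍ[ℝ] × ℍ[ℝ]

/-- Octonionic product: `(a,b)·(c,d) = (a c − (conj d) b, d a + b (conj c))`. -/
def omul (x y : Octo) : Octo :=
  (x.1 * y.1 - star y.2 * x.2, y.2 * x.1 + x.2 * star y.1)

/-- Octonionic conjugation: `conj (a,b) = (conj a, −b)`. -/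
def oconj (x : Octo) : Octo := (star x.1, -x.2)

def oone : Octo := (1, 0)
def oi : Octo := ((⟨0,1,0,0⟩ : ℍ[ℝ]), 0)
def oj : Octo := ((⟨0,0,1,0⟩ : ℍ[ℝ]), 0)
def ok : Octo := ((⟨0,0,0,1⟩ : ℍ[ℝ]), 0)
def ol : Octo := (0, 1)

/-- `h = (i + j + k + l)/2`. -/
def oh : Octo := (2⁻¹ : ℝ) • (oi + oj + ok + ol)

/-- The Coxeter–Dickson basis `b₀,…,b₇`. -/
def b : Fin 8 → Octo :=
  ![oone, oi, oj, ok, oh, omul oi oh, omul oj oh, omul ok oh]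

/-- The Coxeter–Dickson order: the ℤ-span of `b₀,…,b₇`. -/
def CD : Submodule ℤ Octo := Submodule.span ℤ (Set.range b)

/-- The norm: the sum of the squares of the eight real coordinates. -/
def onorm (x : Octo) : ℝ :=
  x.1.re^2 + x.1.imI^2 + x.1.imJ^2 + x.1.imK^2 +
  x.2.re^2 + x.2.imI^2 + x.2.imJ^2 + x.2.imK^2

/-- The bilinear form `⟨x,y⟩`, obtained by polarization of the norm,
so that `x·(conj y) + y·(conj x) = ⟨x,y⟩·1`. -/
def binner (x y : Octo) : ℝ := onorm (x + y) - onorm x - onorm y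

open scoped Matrix

/-- The row of real coordinates of an octonion. -/
def octoCoords : Octo →ₗ[ℝ] Fin 8 → ℝ where
  toFun x := ![x.1.re, x.1.imI, x.1.imJ, x.1.imK, x.2.re, x.2.imI, x.2.imJ, x.2.imK]
  map_add' x y := by simp
  map_smul' r x := by simp

theorem octoCoords_apply (x : Octo) :
    octoCoords x = ![x.1.re, x.1.imI, x.1.imJ, x.1.imK, x.2.re, x.2.imI, x.2.imJ, x.2.imK] :=
  rfl

theorem onorm_eq_dotProduct (x : Octo) : onorm x = octoCoords x ⬝ᵥ octoCoords x := by
  simp [onorm, octoCoords_apply, dotProduct, Fin.sum_univ_eight]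
  ring

theorem binner_eq_two_mul_dotProduct (x y : Octo) :
    binner x y = 2 * (octoCoords x ⬝ᵥ octoCoords y) := by
  simp only [binner, onorm_eq_dotProduct, map_add, add_dotProduct, dotProduct_add,
    dotProduct_comm (octoCoords y)]
  ring

/-- The coordinates of the Coxeter–Dickson basis, one basis vector in each row. -/
def basisCoords : Matrix (Fin 8) (Fin 8) ℝ :=
  !![1, 0, 0, 0, 0, 0, 0, 0;
     0, 1, 0, 0, 0, 0, 0, 0;
     0, 0, 1, 0, 0, 0, 0, 0;
     0, 0, 0, 1, 0, 0, 0, 0;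
     0, 2⁻¹, 2⁻¹, 2⁻¹, 2⁻¹, 0, 0, 0;
     -2⁻¹, 0, -2⁻¹, 2⁻¹, 0, 2⁻¹, 0, 0;
     -2⁻¹, 2⁻¹, 0, -2⁻¹, 0, 0, 2⁻¹, 0;
     -2⁻¹, -2⁻¹, 2⁻¹, 0, 0, 0, 0, 2⁻¹]

theorem octoCoords_omul (x y : Octo) : octoCoords (omul x y) =
    ![x.1.re * y.1.re - x.1.imI * y.1.imI - x.1.imJ * y.1.imJ - x.1.imK * y.1.imK
        - (y.2.re * x.2.re + y.2.imI * x.2.imI + y.2.imJ * x.2.imJ + y.2.imK * x.2.imK),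
      x.1.re * y.1.imI + x.1.imI * y.1.re + x.1.imJ * y.1.imK - x.1.imK * y.1.imJ
        - (y.2.re * x.2.imI - y.2.imI * x.2.re - y.2.imJ * x.2.imK + y.2.imK * x.2.imJ),
      x.1.re * y.1.imJ - x.1.imI * y.1.imK + x.1.imJ * y.1.re + x.1.imK * y.1.imI
        - (y.2.re * x.2.imJ + y.2.imI * x.2.imK - y.2.imJ * x.2.re - y.2.imK * x.2.imI),
      x.1.re * y.1.imK + x.1.imI * y.1.imJ - x.1.imJ * y.1.imI + x.1.imK * y.1.re
        - (y.2.re * x.2.imK - y.2.imI * x.2.imJ + y.2.imJ * x.2.imI - y.2.imK * x.2.re),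
      y.2.re * x.1.re - y.2.imI * x.1.imI - y.2.imJ * x.1.imJ - y.2.imK * x.1.imK
        + (x.2.re * y.1.re + x.2.imI * y.1.imI + x.2.imJ * y.1.imJ + x.2.imK * y.1.imK),
      y.2.re * x.1.imI + y.2.imI * x.1.re + y.2.imJ * x.1.imK - y.2.imK * x.1.imJ
        + (-x.2.re * y.1.imI + x.2.imI * y.1.re - x.2.imJ * y.1.imK + x.2.imK * y.1.imJ),
      y.2.re * x.1.imJ - y.2.imI * x.1.imK + y.2.imJ * x.1.re + y.2.imK * x.1.imI
        + (-x.2.re * y.1.imJ + x.2.imI * y.1.imK + x.2.imJ * y.1.re - x.2.imK * y.1.imI),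
      y.2.re * x.1.imK + y.2.imI * x.1.imJ - y.2.imJ * x.1.imI + y.2.imK * x.1.re
        + (-x.2.re * y.1.imK - x.2.imI * y.1.imJ + x.2.imJ * y.1.imI + x.2.imK * y.1.re)] := by
  simp [octoCoords_apply, omul]
  ring_nf
  simp

theorem octoCoords_oh : octoCoords oh = ![0, 2⁻¹, 2⁻¹, 2⁻¹, 2⁻¹, 0, 0, 0] := by
  simp only [oh, map_smul, map_add]
  simp [octoCoords_apply, oi, oj, ok, ol]

theorem octoCoords_b (i : Fin 8) : octoCoords (b i) = basisCoords i := by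
  have h := octoCoords_oh
  simp only [octoCoords_apply, Matrix.vecCons_inj] at h
  change octoCoords (b i) = Matrix.of.symm basisCoords i
  fin_cases i <;> simp [octoCoords_omul, octoCoords_oh, b, basisCoords]
  all_goals simp [octoCoords_apply, h, oone, oi, oj, ok]

theorem det_basisCoords : basisCoords.det = 2⁻¹ ^ 4 := by
  rw [Matrix.det_of_isLowerTriangular]
  · simp [basisCoords, Fin.prod_univ_eight]
    norm_num
  · intro i j hij
    change i < j at hij
    fin_cases i <;> fin_cases j <;> first | rfl | exact absurd hij (by decide)

theorem exists_int_onorm {x : Octo} (hx : x ∈ CD) : ∃ m : ℤ, onorm x = m := by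
  obtain ⟨c, rfl⟩ := (Submodule.mem_span_range_iff_exists_fun ℤ).1 hx
  refine ⟨∑ i, c i ^ 2 - c 0 * (c 5 + c 6 + c 7) + c 1 * (c 4 + c 6 - c 7)
    + c 2 * (c 4 - c 5 + c 7) + c 3 * (c 4 + c 5 - c 6), ?_⟩
  have h : octoCoords (∑ i, c i • b i) = (fun i => (c i : ℝ)) ᵥ* basisCoords := by
    ext j
    simp only [map_sum, map_zsmul, octoCoords_b]
    simp [Matrix.vecMul, dotProduct]
  rw [onorm_eq_dotProduct, h]
  simp [Fin.sum_univ_eight, basisCoords, Matrix.vecMul, dotProduct]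
  ring

/-- the Coxeter–Dickson order is an even unimodular lattice of
rank 8: the Gram matrix `⟨b_i,b_j⟩` has determinant 1 and `⟨x,x⟩ ∈ 2ℤ` on `Λ`. -/
theorem coxeterDickson_even_unimodular :
    (Matrix.of fun i j : Fin 8 => binner (b i) (b j)).det = 1 ∧
    (∀ x ∈ CD, ∃ m : ℤ, binner x x = 2 * (m : ℝ)) := by
  constructor
  · have h : (Matrix.of fun i j : Fin 8 => binner (b i) (b j)) =
        (2 : ℝ) • (basisCoords * basisCoords.transpose) := by
      ext i j
      simp [binner_eq_two_mul_dotProduct, octoCoords_b, Matrix.mul_apply, dotProduct]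
    rw [h, Matrix.det_smul, Matrix.det_mul, Matrix.det_transpose, det_basisCoords]
    norm_num
  · intro x hx
    obtain ⟨m, hm⟩ := exists_int_onorm hx
    exact ⟨m, by rw [binner_eq_two_mul_dotProduct, ← onorm_eq_dotProduct, hm]⟩

end
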